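/- (Exchange lemma) Let N be an abelian network with alphabet A, and let x.q be a configuration. If w1 and w2 are two legal executions for x.q, then there exists a word w ∈ A* such that the concatenation w1·w is a legal execution for x.q and |w1| + |w| = max(|w1|, |w2|), the coordinatewise maximum; in fact w = w2 ∖ |w1| has this property. -/

import Mathlib

namespace AbelianNetworks

/-- An abelian network on the alphabet `A` with state set `Q`: commuting transition maps
`t a : Q → Q` and message-passing vectors `msg a : Q → ℕ^A` satisfying the abelian axioms. -/
structure Network (A Q : Type*) where
  t : A → Q → Q
  msg : A → Q → A → ℕ
  t_comm : ∀ a b q, t a (t b q) = t b (t a q)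
  msg_comm : ∀ a b q c, msg a q c + msg b (t a q) c = msg b q c + msg a (t b q) c

namespace Network

variable {A Q : Type*} [DecidableEq A] (N : Network A Q)

/-- The state obtained after processing the word `w` (letters processed left to right). -/
def tw : List A → Q → Q
  | [], q => q
  | a :: w, q => tw w (N.t a q)

/-- The vector of messages generated while processing the word `w` from state `q`. -/
def nw : List A → Q → A → ℕ
  | [], _, _ => 0
  | a :: w, q, c => N.msg a q c + nw w (N.t a q) c

/-- The configuration transition: `π_w (x.q) = (x + N_w(q) - |w|).t_w(q)`. -/
def piW (w : List A) (c : (A → ℤ) × Q) : (A → ℤ) × Q :=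
  (fun a => c.1 a + (nw N w c.2 a : ℤ) - (w.count a : ℤ), tw N w c.2)

/-- `w` is a legal execution for the configuration `c`: each executed letter has at least
one pending copy at the moment it is executed. -/
def Legal : (A → ℤ) × Q → List A → Prop
  | _, [] => True
  | c, a :: w => 1 ≤ c.1 a ∧ Legal (piW N [a] c) w

end Network

/-- The removal `w ∖ n` of a vector `n ∈ ℕ^A` from a word `w`: delete, for each letter `a`,
the first `n a` occurrences of `a` from `w`. -/
def removeVec {A : Type*} [DecidableEq A] : List A → (A → ℕ) → List A
  | [], _ => []
  | a :: w, n =>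
      if n a = 0 then a :: removeVec w n
      else removeVec w (Function.update n a (n a - 1))

theorem removeVec_zero {A : Type*} [DecidableEq A] (w : List A) :
    removeVec w (fun _ => 0) = w := by
  induction w with
  | nil => rfl
  | cons a w ih => simp [removeVec, ih]

theorem removeVec_update_succ {A : Type*} [DecidableEq A] (w : List A) (a : A) (n : A → ℕ) :
    removeVec w (Function.update n a (n a + 1)) = removeVec (w.erase a) n := by
  induction w generalizing n with
  | nil => rfl
  | cons b w ih =>
    by_cases h : b = a
    · subst h
      simp [removeVec]
    · have hcomm : Function.update (Function.update n a (n a + 1)) b (n b - 1) =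
          Function.update (Function.update n b (n b - 1)) a
            (Function.update n b (n b - 1) a + 1) := by
        rw [Function.update_comm h, Function.update_of_ne (Ne.symm h)]
      rw [List.erase_cons_tail (by simpa using h)]
      simp only [removeVec, Function.update_of_ne h, ih, hcomm]

theorem count_removeVec {A : Type*} [DecidableEq A] (w : List A) (n : A → ℕ) (a : A) :
    (removeVec w n).count a = w.count a - n a := by
  induction w generalizing n with
  | nil => simp [removeVec]
  | cons b w ih =>
    by_cases h : b = a
    · subst h
      by_cases hn : n b = 0
      · simp [removeVec, hn, ih]
      · simp only [removeVec, hn, if_false, ih, Function.update_self, List.count_cons_self]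
        omega
    · by_cases hn : n b = 0
      · simp [removeVec, hn, ih, List.count_cons_of_ne h]
      · simp [removeVec, hn, ih, List.count_cons_of_ne h, Function.update_of_ne (Ne.symm h)]

namespace Network

variable {A Q : Type*} [DecidableEq A] (N : Network A Q)

theorem piW_singleton_comm (a b : A) (c : (A → ℤ) × Q) :
    piW N [b] (piW N [a] c) = piW N [a] (piW N [b] c) := by
  refine Prod.ext (funext fun d => ?_) (N.t_comm b a c.2)
  have h := N.msg_comm a b c.2 d
  simp only [piW, nw, tw]
  omega

theorem le_piW_singleton_apply {a b : A} (h : b ≠ a) (c : (A → ℤ) × Q) :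
    c.1 b ≤ (piW N [a] c).1 b := by
  simp [piW, List.count_cons_of_ne h.symm]

variable {N} in
theorem Legal.erase {c : (A → ℤ) × Q} {w : List A} (hw : N.Legal c w) {a : A}
    (ha : 1 ≤ c.1 a) : N.Legal (piW N [a] c) (w.erase a) := by
  induction w generalizing c with
  | nil => trivial
  | cons b w ih =>
    obtain ⟨hb, hw⟩ := hw
    by_cases h : b = a
    · subst h
      simpa using hw
    · rw [List.erase_cons_tail (by simpa using h)]
      refine ⟨hb.trans (N.le_piW_singleton_apply h c), ?_⟩
      rw [piW_singleton_comm]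
      exact ih hw (ha.trans (N.le_piW_singleton_apply (Ne.symm h) c))

variable {N} in
theorem Legal.append_removeVec {c : (A → ℤ) × Q} {w₁ w₂ : List A} (h₁ : N.Legal c w₁)
    (h₂ : N.Legal c w₂) : N.Legal c (w₁ ++ removeVec w₂ fun a => w₁.count a) := by
  induction w₁ generalizing c w₂ with
  | nil => simpa [removeVec_zero] using h₂
  | cons a w ih =>
    have hcount : (fun b => (a :: w).count b) =
        Function.update (fun b => w.count b) a (w.count a + 1) := by
      funext b
      by_cases h : b = a
      · subst h
        simp
      · simp [Function.update_of_ne h, List.count_cons_of_ne (Ne.symm h)]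
    rw [hcount, removeVec_update_succ w₂ a fun b => w.count b]
    exact ⟨h₁.1, ih h₁.2 (h₂.erase h₁.1)⟩

end Network

/-- **Exchange lemma.**  If `w₁` and `w₂` are two legal executions for the configuration
`c`, then there is a word `w` (namely `w = w₂ ∖ |w₁|`) such that `w₁ ++ w` is a legal
execution for `c` and `|w₁| + |w| = max (|w₁|, |w₂|)` coordinatewise. -/
theorem Network.exchange {A Q : Type*} [DecidableEq A] (N : Network A Q)
    (c : (A → ℤ) × Q) (w₁ w₂ : List A)
    (h₁ : N.Legal c w₁) (h₂ : N.Legal c w₂) :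
    N.Legal c (w₁ ++ removeVec w₂ fun a => w₁.count a) ∧
    ∀ a, w₁.count a + (removeVec w₂ fun b => w₁.count b).count a =
      max (w₁.count a) (w₂.count a) := by
  refine ⟨h₁.append_removeVec h₂, fun a => ?_⟩
  rw [count_removeVec]
  omega

end AbelianNetworks
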